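/- arXiv:0810.5269 — 2 statements merged into one kernel-verified Lean document; each statement's English description precedes it below -/
import Mathlib

section
/- Let A, B ∈ GL(2, ℤ) be hyperbolic and let q be the minimal eventual period of the continued fraction expansion of the unstable slope κ_A of A. If q is odd and there exists C ∈ GL(2, ℤ) with B = C A C⁻¹, then there exists D ∈ SL(2, ℤ) (i.e. det D = 1) with B = D A D⁻¹. -/
/-- The orbit of `x` under the Gauss (continued fraction) map:
`x₀ = x`, `x_{n+1} = 1/(xₙ - ⌊xₙ⌋)`. -/
noncomputable def cfracAux (x : ℝ) : ℕ → ℝ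
  | 0 => x
  | n + 1 => 1 / Int.fract (cfracAux x n)

/-- The continued fraction partial quotient sequence of `x`:
`a n = ⌊xₙ⌋` in the standard continued fraction algorithm. -/
noncomputable def cfrac (x : ℝ) (n : ℕ) : ℤ := ⌊cfracAux x n⌋

theorem irrational_cfracAux {x : ℝ} (hx : Irrational x) (n : ℕ) :
    Irrational (cfracAux x n) := by
  induction n with
  | zero => exact hx
  | succ n ih =>
    have h : Irrational (Int.fract (cfracAux x n)) := ih.sub_intCast _
    simpa [cfracAux] using h.inv

theorem one_lt_cfracAux_succ {x : ℝ} (hx : Irrational x) (n : ℕ) :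
    1 < cfracAux x (n + 1) := by
  have h : Irrational (Int.fract (cfracAux x n)) := (irrational_cfracAux hx n).sub_intCast _
  have h0 : 0 < Int.fract (cfracAux x n) := lt_of_le_of_ne (Int.fract_nonneg _) h.ne_zero.symm
  exact (one_lt_div h0).2 (Int.fract_lt_one _)

theorem cfracAux_eq_add (x : ℝ) (n : ℕ) :
    cfracAux x n = cfrac x n + 1 / cfracAux x (n + 1) := by
  simp [cfracAux, cfrac, Int.floor_add_fract]

theorem two_le_cfracAux_mul {x : ℝ} (hx : Irrational x) (n : ℕ) :
    2 ≤ cfracAux x (n + 1) * cfracAux x (n + 2) := by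
  have h1 := one_lt_cfracAux_succ hx n
  have h2 := one_lt_cfracAux_succ hx (n + 1)
  have ha : (1 : ℝ) ≤ cfrac x (n + 1) := by
    have : (1 : ℤ) ≤ cfrac x (n + 1) := Int.le_floor.2 (by exact_mod_cast h1.le)
    exact_mod_cast this
  rw [cfracAux_eq_add x (n + 1), add_mul, one_div, inv_mul_cancel₀ (by positivity)]
  nlinarith

/-- A tail of the continued fraction algorithm is determined by its partial quotients. -/
theorem cfracAux_eq_of_cfrac_eq {x : ℝ} (hx : Irrational x) {m n : ℕ}
    (h : ∀ k, cfrac x (m + k) = cfrac x (n + k)) : cfracAux x m = cfracAux x n := by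
  have step : ∀ k, |cfracAux x (m + k) - cfracAux x (n + k)| =
      |cfracAux x (m + k + 1) - cfracAux x (n + k + 1)| /
        (cfracAux x (m + k + 1) * cfracAux x (n + k + 1)) := by
    intro k
    have h1 := one_lt_cfracAux_succ hx (m + k)
    have h2 := one_lt_cfracAux_succ hx (n + k)
    rw [cfracAux_eq_add x (m + k), cfracAux_eq_add x (n + k), h k, add_sub_add_left_eq_sub,
      div_sub_div _ _ (by positivity) (by positivity), abs_div, one_mul, mul_one, abs_sub_comm,
      abs_of_pos (a := _ * _) (by positivity)]
  have step2 : ∀ k, 4 * |cfracAux x (m + k) - cfracAux x (n + k)| ≤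
      |cfracAux x (m + (k + 2)) - cfracAux x (n + (k + 2))| := by
    intro k
    have h1 := two_le_cfracAux_mul hx (m + k)
    have h2 := two_le_cfracAux_mul hx (n + k)
    have h3 := one_lt_cfracAux_succ hx (m + k)
    have h4 := one_lt_cfracAux_succ hx (n + k)
    have h5 := one_lt_cfracAux_succ hx (m + k + 1)
    have h6 := one_lt_cfracAux_succ hx (n + k + 1)
    have e := step (k + 1)
    simp only [← add_assoc] at e ⊢
    rw [step k, e, div_div, mul_div_assoc', div_le_iff₀ (by positivity), mul_comm]
    refine mul_le_mul_of_nonneg_left ?_ (abs_nonneg _)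
    calc (4 : ℝ) = 2 * 2 := by norm_num
      _ ≤ _ := mul_le_mul h1 h2 (by norm_num) (by positivity)
      _ = _ := by ring
  have bound : ∀ j k, |cfracAux x (m + k) - cfracAux x (n + k)| ≤ (1 / 4 : ℝ) ^ j := by
    intro j
    induction j with
    | zero =>
      intro k
      rw [pow_zero]
      exact (Int.abs_sub_lt_one_of_floor_eq_floor (h k)).le
    | succ j ih =>
      intro k
      have := step2 k
      have := ih (k + 2)
      rw [pow_succ]
      linarith
  have hlim := tendsto_pow_atTop_nhds_zero_of_lt_one (r := (1 / 4 : ℝ)) (by norm_num) (by norm_num)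
  have := ge_of_tendsto' hlim fun j => bound j 0
  simpa [sub_eq_zero] using this

/-- The continued fraction algorithm acts on slopes by integer matrices of determinant `(-1) ^ n`. -/
theorem exists_mulVec_cfracAux {x : ℝ} (hx : Irrational x) (n : ℕ) :
    ∃ M : Matrix.GeneralLinearGroup (Fin 2) ℤ,
      (M : Matrix (Fin 2) (Fin 2) ℤ).det = (-1) ^ n ∧ ∃ c : ℝ, c ≠ 0 ∧
        Matrix.mulVec ((M : Matrix (Fin 2) (Fin 2) ℤ).map (Int.cast : ℤ → ℝ))
          ![cfracAux x n, 1] = c • ![x, 1] := by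
  induction n with
  | zero => exact ⟨1, by simp, 1, one_ne_zero, by simp [cfracAux]⟩
  | succ n ih =>
    obtain ⟨M, hM, c, hc, hv⟩ := ih
    let T : Matrix (Fin 2) (Fin 2) ℤ := !![cfrac x n, 1; 1, 0]
    have hT : T.det = -1 := by simp [T, Matrix.det_fin_two]
    have hy : cfracAux x (n + 1) ≠ 0 := (irrational_cfracAux hx _).ne_zero
    have hTv : Matrix.mulVec (T.map (Int.cast : ℤ → ℝ)) ![cfracAux x (n + 1), 1] =
        cfracAux x (n + 1) • ![cfracAux x n, 1] := by
      ext i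
      fin_cases i
      · simp [T, Matrix.mulVec, dotProduct, Fin.sum_univ_two]
        rw [cfracAux_eq_add x n]
        field_simp
      · simp [T, Matrix.mulVec, dotProduct, Fin.sum_univ_two]
    refine ⟨M * Matrix.GeneralLinearGroup.mk'' T (by rw [hT]; exact isUnit_one.neg), ?_,
      cfracAux x (n + 1) * c, mul_ne_zero hy hc, ?_⟩
    · have : (M.1 * T).det = (-1) ^ (n + 1) := by rw [Matrix.det_mul, hM, hT, pow_succ]
      exact this
    · have : Matrix.mulVec ((M.1 * T).map (Int.cast : ℤ → ℝ)) ![cfracAux x (n + 1), 1] =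
          (cfracAux x (n + 1) * c) • ![x, 1] := by
        rw [Matrix.map_mul_intCast, ← Matrix.mulVec_mulVec, hTv, Matrix.mulVec_smul, hv, smul_smul]
      exact this

/-- An odd eventual period of the continued fraction of `x` yields an integer matrix of
determinant `-1` fixing the slope `x`. -/
theorem exists_det_neg_one_mulVec_eq_smul {x : ℝ} (hx : Irrational x) {q N : ℕ} (hodd : Odd q)
    (h : ∀ n ≥ N, cfrac x (n + q) = cfrac x n) :
    ∃ E : Matrix.GeneralLinearGroup (Fin 2) ℤ,
      (E : Matrix (Fin 2) (Fin 2) ℤ).det = -1 ∧ ∃ c : ℝ,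
        Matrix.mulVec ((E : Matrix (Fin 2) (Fin 2) ℤ).map (Int.cast : ℤ → ℝ)) ![x, 1] =
          c • ![x, 1] := by
  have hper : cfracAux x (N + q) = cfracAux x N := by
    refine cfracAux_eq_of_cfrac_eq hx fun k => ?_
    rw [add_right_comm]
    exact h _ (Nat.le_add_right _ _)
  obtain ⟨M, hM, c, hc, hv⟩ := exists_mulVec_cfracAux hx N
  obtain ⟨M', hM', c', -, hv'⟩ := exists_mulVec_cfracAux hx (N + q)
  rw [hper] at hv'
  have hmul : (M' * M⁻¹).1 * M.1 = M'.1 := by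
    rw [← Units.val_mul, inv_mul_cancel_right]
  refine ⟨M' * M⁻¹, ?_, c⁻¹ * c', ?_⟩
  · have hd := congrArg Matrix.det hmul
    rw [Matrix.det_mul, hM, hM', pow_add, hodd.neg_one_pow, mul_comm] at hd
    exact mul_left_cancel₀ (pow_ne_zero _ (by norm_num)) hd
  · rw [← hmul, Matrix.map_mul_intCast, ← Matrix.mulVec_mulVec, hv, Matrix.mulVec_smul] at hv'
    rw [mul_smul, ← hv', inv_smul_smul₀ hc]

/-- Integer matrices sharing an eigenvector of irrational slope commute. -/
theorem mul_comm_of_mulVec_eq_smul {x : ℝ} (hx : Irrational x) {A E : Matrix (Fin 2) (Fin 2) ℤ}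
    {a e : ℝ} (hA : Matrix.mulVec (A.map (Int.cast : ℤ → ℝ)) ![x, 1] = a • ![x, 1])
    (hE : Matrix.mulVec (E.map (Int.cast : ℤ → ℝ)) ![x, 1] = e • ![x, 1]) :
    A * E = E * A := by
  have hv : Matrix.mulVec ((A * E - E * A).map (Int.cast : ℤ → ℝ)) ![x, 1] = 0 := by
    rw [Matrix.map_sub _ (by simp), Matrix.map_mul_intCast, Matrix.map_mul_intCast,
      Matrix.sub_mulVec, ← Matrix.mulVec_mulVec, ← Matrix.mulVec_mulVec, hA, hE,
      Matrix.mulVec_smul, Matrix.mulVec_smul, hA, hE, smul_comm, sub_self]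
  rw [← sub_eq_zero]
  generalize A * E - E * A = Z at hv
  have hrow : ∀ i, Z i 0 = 0 ∧ Z i 1 = 0 := by
    intro i
    have hi : (Z i 0 : ℝ) * x + Z i 1 = 0 := by
      simpa [Matrix.mulVec, dotProduct, Fin.sum_univ_two] using congrFun hv i
    have h0 : Z i 0 = 0 := by
      by_contra hne
      exact ((hx.intCast_mul hne).add_intCast (Z i 1)).ne_zero hi
    refine ⟨h0, ?_⟩
    simpa [h0] using hi
  ext i j
  fin_cases j
  · exact (hrow i).1
  · exact (hrow i).2

/-- The unstable slope of a hyperbolic integer matrix is irrational. -/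
theorem irrational_of_mulVec_eq_smul (A : Matrix.GeneralLinearGroup (Fin 2) ℤ) {x a : ℝ}
    (hA : Matrix.mulVec ((A : Matrix (Fin 2) (Fin 2) ℤ).map (Int.cast : ℤ → ℝ)) ![x, 1] =
      a • ![x, 1]) (ha : 1 < |a|) : Irrational x := by
  have h0 : (A.1 0 0 : ℝ) * x + A.1 0 1 = a * x := by
    simpa [Matrix.mulVec, dotProduct, Fin.sum_univ_two] using congrFun hA 0
  have h1 : (A.1 1 0 : ℝ) * x + A.1 1 1 = a := by
    simpa [Matrix.mulVec, dotProduct, Fin.sum_univ_two] using congrFun hA 1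
  have hdet : a * ((A.1 0 0 : ℝ) + A.1 1 1 - a) = (A.1.det : ℤ) := by
    rw [Matrix.det_fin_two]
    push_cast
    linear_combination (A.1 1 0 : ℝ) * h0 - (A.1 0 0 - a) * h1
  rintro ⟨r, rfl⟩
  obtain ⟨s, rfl⟩ : ∃ s : ℚ, (s : ℝ) = a := ⟨A.1 1 0 * r + A.1 1 1, by push_cast; exact h1⟩
  have hs : s * ((A.1 0 0 : ℚ) + A.1 1 1 - s) = (A.1.det : ℤ) := by
    apply (Rat.cast_injective (α := ℝ))
    simpa only [Rat.cast_mul, Rat.cast_sub, Rat.cast_add, Rat.cast_intCast] using hdet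
  obtain ⟨k, rfl⟩ : ∃ k : ℤ, (k : ℚ) = s := by
    refine IsIntegrallyClosed.isIntegral_iff.1
      ⟨Polynomial.X ^ 2 - (Polynomial.C (A.1 0 0 + A.1 1 1) * Polynomial.X -
        Polynomial.C A.1.det), ?_, ?_⟩
    · monicity!
    · simp only [Polynomial.eval₂_sub, Polynomial.eval₂_pow, Polynomial.eval₂_X,
        Polynomial.eval₂_mul, Polynomial.eval₂_C]
      simp only [eq_intCast, Int.cast_add]
      linear_combination -hs
  have hk : k * (A.1 0 0 + A.1 1 1 - k) = A.1.det := by exact_mod_cast hs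
  have hu : IsUnit k := isUnit_of_dvd_unit ⟨_, hk.symm⟩ ((Matrix.isUnit_iff_isUnit_det _).1 A.isUnit)
  rcases Int.isUnit_iff.1 hu with rfl | rfl <;> norm_num at ha

/-- Let `A, B ∈ GL(2, ℤ)` be hyperbolic, and let `q` be the minimal
eventual period of the continued fraction expansion of the unstable slope `κ_A` of `A`.
If `q` is odd and `A, B` are conjugate in `GL(2, ℤ)`, then they are conjugate in
`SL(2, ℤ)`, i.e. via some `D` with `det D = 1`. -/
theorem stmt_12
    (A B : Matrix.GeneralLinearGroup (Fin 2) ℤ)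
    (κA κB lamA lamB : ℝ)
    (hA : Matrix.mulVec ((A : Matrix (Fin 2) (Fin 2) ℤ).map (Int.cast : ℤ → ℝ)) ![κA, 1]
        = lamA • ![κA, 1])
    (hlamA : 1 < |lamA|)
    (hB : Matrix.mulVec ((B : Matrix (Fin 2) (Fin 2) ℤ).map (Int.cast : ℤ → ℝ)) ![κB, 1]
        = lamB • ![κB, 1])
    (hlamB : 1 < |lamB|)
    (q : ℕ)
    (hq : IsLeast {q' : ℕ | 0 < q' ∧ ∃ N : ℕ, ∀ n ≥ N, cfrac κA (n + q') = cfrac κA n} q)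
    (hodd : Odd q)
    (hconj : ∃ C : Matrix.GeneralLinearGroup (Fin 2) ℤ, B = C * A * C⁻¹) :
    ∃ D : Matrix.GeneralLinearGroup (Fin 2) ℤ,
      Matrix.det (D : Matrix (Fin 2) (Fin 2) ℤ) = 1 ∧ B = D * A * D⁻¹ := by
  obtain ⟨C, rfl⟩ := hconj
  rcases Int.isUnit_iff.1 ((Matrix.isUnit_iff_isUnit_det _).1 C.isUnit) with hC | hC
  · exact ⟨C, hC, rfl⟩
  have hκ := irrational_of_mulVec_eq_smul A hA hlamA
  obtain ⟨N, hN⟩ := hq.1.2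
  obtain ⟨E, hE, c, hc⟩ := exists_det_neg_one_mulVec_eq_smul hκ hodd hN
  have hAE : A * E = E * A := Units.ext (mul_comm_of_mulVec_eq_smul hκ hA hc)
  refine ⟨C * E, ?_, ?_⟩
  · rw [Units.val_mul, Matrix.det_mul, hC, hE]
    norm_num
  · rw [mul_inv_rev, mul_assoc C E A, ← hAE]
    group
end

section
/- Let A, B ∈ GL(2, ℤ) be hyperbolic and let q be the minimal eventual period of the continued fraction expansion of the unstable slope κ_A of A. If q is even and there exists C ∈ GL(2, ℤ) with det C = −1 and B = C A C⁻¹, then there is no D ∈ SL(2, ℤ) with B = D A D⁻¹. -/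
/-- `TailEquiv ε x y`: the Gauss orbits of `x` and `y` meet, after `m` and `n` steps respectively,
with `(-1) ^ (m + n) = ε`. -/
def TailEquiv (ε : ℤ) (x y : ℝ) : Prop :=
  ∃ m n : ℕ, cfracAux x m = cfracAux y n ∧ (-1 : ℤ) ^ (m + n) = ε

theorem cfracAux_add (x : ℝ) (m n : ℕ) :
    cfracAux x (m + n) = cfracAux (cfracAux x m) n := by
  induction n with
  | zero => rfl
  | succ n ih => rw [← add_assoc, cfracAux, ih, cfracAux]

theorem cfracAux_one (x : ℝ) : cfracAux x 1 = 1 / Int.fract x := rfl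

theorem cfracAux_two (x : ℝ) : cfracAux x 2 = 1 / Int.fract (cfracAux x 1) := rfl

theorem cfracAux_three (x : ℝ) : cfracAux x 3 = 1 / Int.fract (cfracAux x 2) := rfl

namespace TailEquiv

theorem symm {ε : ℤ} {x y : ℝ} (h : TailEquiv ε x y) : TailEquiv ε y x := by
  obtain ⟨m, n, h, hs⟩ := h
  exact ⟨n, m, h.symm, by rwa [add_comm]⟩

theorem trans {ε δ : ℤ} {x y z : ℝ} (h : TailEquiv ε x y) (h' : TailEquiv δ y z) :
    TailEquiv (ε * δ) x z := by
  obtain ⟨m, n, h, rfl⟩ := h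
  obtain ⟨k, l, h', rfl⟩ := h'
  refine ⟨m + k, l + n, ?_, ?_⟩
  · rw [cfracAux_add, h, ← cfracAux_add, cfracAux_add z, ← h', ← cfracAux_add, add_comm]
  · rw [← pow_add]
    congr 1
    ring

theorem refl (x : ℝ) : TailEquiv 1 x x := ⟨0, 0, rfl, rfl⟩

theorem add_one (x : ℝ) : TailEquiv 1 x (x + 1) :=
  ⟨1, 1, by simp [cfracAux_one], rfl⟩

end TailEquiv

theorem Irrational.fract_pos {x : ℝ} (hx : Irrational x) : 0 < Int.fract x := by
  refine lt_of_le_of_ne (Int.fract_nonneg x) fun h => hx.ne_int ⌊x⌋ ?_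
  have := Int.floor_add_fract x
  linarith

theorem fract_neg_eq_one_sub {x : ℝ} (hx : Irrational x) :
    Int.fract (-x) = 1 - Int.fract x :=
  Int.fract_neg hx.fract_pos.ne'

theorem TailEquiv.neg_of_fract_lt {x : ℝ} (hx : Irrational x) (h : Int.fract x < 1 / 2) :
    TailEquiv (-1) x (-x) := by
  refine ⟨2, 3, ?_, rfl⟩
  have h0 := hx.fract_pos
  have h1 : cfracAux (-x) 1 = 1 / (1 - Int.fract x) := by
    rw [cfracAux_one, fract_neg_eq_one_sub hx]
  have h1' : (1 : ℝ) - Int.fract x ≠ 0 := by linarith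
  have h2 : Int.fract (cfracAux (-x) 1) = Int.fract x / (1 - Int.fract x) := by
    rw [h1, Int.fract_eq_iff]
    refine ⟨by apply div_nonneg <;> linarith, ?_, 1, ?_⟩
    · rw [div_lt_one (by linarith)]
      linarith
    · push_cast
      field_simp
  have h3 : cfracAux (-x) 2 = 1 / Int.fract x - 1 := by
    rw [cfracAux_two, h2]
    field_simp
  rw [cfracAux_three, h3, Int.fract_sub_one, cfracAux_two, cfracAux_one]

theorem TailEquiv.neg {x : ℝ} (hx : Irrational x) : TailEquiv (-1) x (-x) := by
  rcases lt_or_ge (Int.fract x) (1 / 2) with h | h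
  · exact TailEquiv.neg_of_fract_lt hx h
  · have h' : Int.fract x ≠ 1 / 2 := fun e => by
      refine hx ⟨⌊x⌋ + 1 / 2, ?_⟩
      push_cast
      rw [← e, Int.floor_add_fract]
    have h2 : Int.fract (-x) < 1 / 2 := by
      rw [fract_neg_eq_one_sub hx]
      have := lt_of_le_of_ne h h'.symm
      linarith
    have h3 := TailEquiv.neg_of_fract_lt hx.neg h2
    rw [neg_neg] at h3
    exact h3.symm

theorem TailEquiv.inv_of_lt_one {x : ℝ} (h0 : 0 < x) (h1 : x < 1) :
    TailEquiv (-1) x x⁻¹ :=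
  ⟨1, 0, by rw [cfracAux_one, Int.fract_eq_self.2 ⟨h0.le, h1⟩, one_div]; rfl, rfl⟩

theorem TailEquiv.inv_of_pos {x : ℝ} (hx : Irrational x) (h0 : 0 < x) :
    TailEquiv (-1) x x⁻¹ := by
  rcases lt_or_gt_of_ne hx.ne_one with h | h
  · exact TailEquiv.inv_of_lt_one h0 h
  · have := TailEquiv.inv_of_lt_one (inv_pos.2 h0) (inv_lt_one_of_one_lt₀ h)
    rw [inv_inv] at this
    exact this.symm

theorem TailEquiv.neg_inv {x : ℝ} (hx : Irrational x) : TailEquiv 1 x (-x⁻¹) := by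
  rcases lt_or_gt_of_ne hx.ne_zero with h | h
  · have h1 := TailEquiv.inv_of_pos hx.neg (neg_pos.2 h)
    rw [inv_neg] at h1
    exact (TailEquiv.neg hx).trans h1
  · exact (TailEquiv.inv_of_pos hx h).trans (TailEquiv.neg hx.inv)

open ModularGroup in
/-- The action of `SL(2, ℤ)` by Möbius transformations preserves irrationality and, up to an even
number of steps, the tail of the continued fraction. -/
theorem tailEquiv_of_specialLinearGroup (g : Matrix.SpecialLinearGroup (Fin 2) ℤ) :
    ∀ x y : ℝ, Irrational (x / y) →
      Irrational ((g 0 0 * x + g 0 1 * y) / (g 1 0 * x + g 1 1 * y)) ∧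
      TailEquiv 1 (x / y) ((g 0 0 * x + g 0 1 * y) / (g 1 0 * x + g 1 1 * y)) := by
  have hg : g ∈ Subgroup.closure {S, T} := by
    rw [SpecialLinearGroup.SL2Z_generators]
    trivial
  induction hg using Subgroup.closure_induction'' with
  | one => intro x y h; simpa using ⟨h, TailEquiv.refl _⟩
  | mul g h _ _ ihg ihh =>
    intro x y hxy
    obtain ⟨h1, h2⟩ := ihh x y hxy
    obtain ⟨h3, h4⟩ := ihg _ _ h1
    have h5 := h2.trans h4
    simp only [Matrix.SpecialLinearGroup.coe_mul, Matrix.mul_apply, Fin.sum_univ_two]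
    push_cast
    refine ⟨?_, ?_⟩
    · convert h3 using 2 <;> ring
    · convert h5 using 2 <;> ring
  | mem g hg =>
    intro x y h
    rcases hg with rfl | rfl
    · have e : -y / x = -(x / y)⁻¹ := by rw [inv_div, neg_div]
      simpa [coe_S, e] using
        And.intro (Irrational.neg (Irrational.inv h)) (TailEquiv.neg_inv h)
    · have hy : y ≠ 0 := fun h0 => h.ne_zero (by rw [h0, div_zero])
      have e : (x + y) / y = x / y + 1 := by rw [add_div, div_self hy]
      have h' : Irrational (x / y + 1) := by simpa using Irrational.add_intCast h 1
      simpa [coe_T, e] using And.intro h' (TailEquiv.add_one (x / y))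
  | inv_mem g hg =>
    intro x y h
    rcases hg with rfl | rfl
    · have e : y / -x = -(x / y)⁻¹ := by rw [inv_div, div_neg]
      simpa [coe_S, Matrix.SpecialLinearGroup.coe_inv, Matrix.adjugate_fin_two, e] using
        And.intro (Irrational.neg (Irrational.inv h)) (TailEquiv.neg_inv h)
    · have hy : y ≠ 0 := fun h0 => h.ne_zero (by rw [h0, div_zero])
      have e : (x + -y) / y = x / y - 1 := by rw [add_div, neg_div, div_self hy, sub_eq_add_neg]
      have h' : Irrational (x / y - 1) := by simpa using Irrational.sub_intCast h 1
      have h2 := (TailEquiv.add_one (x / y - 1)).symm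
      rw [sub_add_cancel] at h2
      simpa [coe_T, Matrix.SpecialLinearGroup.coe_inv, Matrix.adjugate_fin_two, e] using
        And.intro h' h2

/-- An irrational number fixed by an integral Möbius transformation of determinant `-1` has a
continued fraction with an odd eventual period. -/
theorem tailEquiv_self_of_det_eq_neg_one {a b c d : ℤ} (hdet : a * d - b * c = -1) {x : ℝ}
    (hx : Irrational x) (hfix : a * x + b = x * (c * x + d)) : TailEquiv (-1) x x := by
  have hne : (c * x + d : ℝ) ≠ 0 := by
    intro h0
    rw [h0, mul_zero] at hfix
    have : ((a * d - b * c : ℤ) : ℝ) = 0 := by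
      push_cast
      linear_combination (a : ℝ) * h0 - c * hfix
    rw [hdet] at this
    norm_num at this
  let g : Matrix.SpecialLinearGroup (Fin 2) ℤ :=
    ⟨!![-a, -b; c, d], by rw [Matrix.det_fin_two_of]; linarith⟩
  have h := (tailEquiv_of_specialLinearGroup g x 1 (by simpa using hx)).2
  have e : (-a * x + -b * 1) / (c * x + d * 1) = -x := by
    rw [mul_one, mul_one, div_eq_iff hne]
    linear_combination -hfix
  simp only [g, Matrix.of_apply, Matrix.cons_val', Matrix.cons_val_zero, Matrix.cons_val_one,
    Matrix.cons_val_fin_one, Int.cast_neg, e, div_one] at h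
  simpa using h.trans (TailEquiv.neg hx).symm

theorem exists_odd_period_of_tailEquiv_self {x : ℝ} (h : TailEquiv (-1) x x) :
    ∃ k : ℕ, Odd k ∧ ∃ N : ℕ, ∀ n ≥ N, cfrac x (n + k) = cfrac x n := by
  obtain ⟨m, n, h, hs⟩ := h
  have hodd : Odd (m + n) := by
    by_contra h'
    rw [Nat.not_odd_iff_even] at h'
    rw [h'.neg_one_pow] at hs
    norm_num at hs
  wlog hmn : m ≤ n generalizing m n
  · exact this n m h.symm (by rwa [add_comm]) (by rwa [add_comm]) (by lia)
  obtain ⟨k, rfl⟩ := Nat.exists_eq_add_of_le hmn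
  refine ⟨k, by grind, m, fun i hi => ?_⟩
  obtain ⟨j, rfl⟩ := Nat.exists_eq_add_of_le hi
  rw [cfrac, cfrac, add_right_comm, cfracAux_add x (m + k), ← h, ← cfracAux_add]

/-- The least eventual period of a sequence divides every eventual period. -/
theorem dvd_of_isLeast_eventual_period {α : Type*} {f : ℕ → α} {q k : ℕ}
    (hq : IsLeast {p : ℕ | 0 < p ∧ ∃ N : ℕ, ∀ n ≥ N, f (n + p) = f n} q)
    (hk : ∃ N : ℕ, ∀ n ≥ N, f (n + k) = f n) : q ∣ k := by
  obtain ⟨⟨hq0, N, hN⟩, hmin⟩ := hq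
  obtain ⟨M, hM⟩ := hk
  have hmul : ∀ j n : ℕ, N ≤ n → f (n + q * j) = f n := by
    intro j
    induction j with
    | zero => simp
    | succ j ih =>
      intro n hn
      rw [Nat.mul_succ, ← add_assoc, hN _ (by lia), ih n hn]
  by_contra hdvd
  have hr : 0 < k % q := Nat.pos_of_ne_zero fun h => hdvd (Nat.dvd_of_mod_eq_zero h)
  refine absurd (hmin ⟨hr, N + M, fun n hn => ?_⟩) (not_le.2 (Nat.mod_lt k hq0))
  rw [← hmul (k / q) _ (by lia), add_assoc, Nat.mod_add_div, hM n (by lia)]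

/-- The slope of an eigenvector of a matrix in `GL(2, ℤ)` for an eigenvalue of modulus
greater than one is irrational. -/
theorem irrational_of_eigenvector {a b c d : ℤ} (hdet : IsUnit (a * d - b * c)) {x l : ℝ}
    (hl : 1 < |l|) (h1 : a * x + b = l * x) (h2 : c * x + d = l) : Irrational x := by
  rintro ⟨r, rfl⟩
  have hr : (r : ℝ) * r.den = r.num := by exact_mod_cast r.mul_den_eq_num
  obtain ⟨u, v, huv⟩ : IsCoprime r.num (r.den : ℤ) := Rat.isCoprime_num_den r
  obtain ⟨L, hL⟩ : ∃ L : ℤ, (L : ℝ) = l := by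
    refine ⟨u * (a * r.num + b * r.den) + v * (c * r.num + d * r.den), ?_⟩
    have huv' : (u * r.num + v * r.den : ℝ) = 1 := by exact_mod_cast huv
    push_cast
    rw [← hr] at huv' ⊢
    linear_combination (u * r.den : ℝ) * h1 + (v * r.den : ℝ) * h2 + l * huv'
  subst hL
  have hchar : L * (a + d - L) = a * d - b * c := by
    have : (L * (a + d - L) : ℝ) = a * d - b * c := by
      linear_combination (c : ℝ) * h1 + (L - a : ℝ) * h2
    exact_mod_cast this
  have hu : IsUnit L := isUnit_of_dvd_unit ⟨_, hchar.symm⟩ hdet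
  rw [Int.isUnit_iff_abs_eq] at hu
  rw [← Int.cast_abs, hu] at hl
  norm_num at hl

/-- Let `A, B ∈ GL(2, ℤ)` be hyperbolic, and let `q` be the minimal
eventual period of the continued fraction expansion of the unstable slope `κ_A` of `A`.
If `q` is even and `B = C A C⁻¹` for some `C ∈ GL(2, ℤ)` with `det C = −1`, then there
is no `D ∈ SL(2, ℤ)` (i.e. with `det D = 1`) conjugating `A` to `B`. -/
theorem stmt_13
    (A B : Matrix.GeneralLinearGroup (Fin 2) ℤ)
    (κA κB lamA lamB : ℝ)
    (hA : Matrix.mulVec ((A : Matrix (Fin 2) (Fin 2) ℤ).map (Int.cast : ℤ → ℝ)) ![κA, 1]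
        = lamA • ![κA, 1])
    (hlamA : 1 < |lamA|)
    (hB : Matrix.mulVec ((B : Matrix (Fin 2) (Fin 2) ℤ).map (Int.cast : ℤ → ℝ)) ![κB, 1]
        = lamB • ![κB, 1])
    (hlamB : 1 < |lamB|)
    (q : ℕ)
    (hq : IsLeast {q' : ℕ | 0 < q' ∧ ∃ N : ℕ, ∀ n ≥ N, cfrac κA (n + q') = cfrac κA n} q)
    (heven : Even q)
    (hconj : ∃ C : Matrix.GeneralLinearGroup (Fin 2) ℤ,
      Matrix.det (C : Matrix (Fin 2) (Fin 2) ℤ) = -1 ∧ B = C * A * C⁻¹) :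
    ¬ ∃ D : Matrix.GeneralLinearGroup (Fin 2) ℤ,
      Matrix.det (D : Matrix (Fin 2) (Fin 2) ℤ) = 1 ∧ B = D * A * D⁻¹ := by
  rintro ⟨D, hD, hBD⟩
  obtain ⟨C, hC, hBC⟩ := hconj
  have hcomm : (D⁻¹ * C) * A = A * (D⁻¹ * C) := by
    have h : C * A * C⁻¹ = D * A * D⁻¹ := hBC.symm.trans hBD
    calc (D⁻¹ * C) * A = D⁻¹ * (C * A * C⁻¹) * C := by group
      _ = A * (D⁻¹ * C) := by rw [h]; group
  have hdet : Matrix.det ((D⁻¹ * C : Matrix.GeneralLinearGroup (Fin 2) ℤ) :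
      Matrix (Fin 2) (Fin 2) ℤ) = -1 := by
    have h : Matrix.det ((D * (D⁻¹ * C) : Matrix.GeneralLinearGroup (Fin 2) ℤ) :
        Matrix (Fin 2) (Fin 2) ℤ) = -1 := by rw [mul_inv_cancel_left, hC]
    rwa [Units.val_mul, Matrix.det_mul, hD, one_mul] at h
  generalize D⁻¹ * C = E at hcomm hdet
  have hunit : IsUnit (Matrix.det (A : Matrix (Fin 2) (Fin 2) ℤ)) :=
    (Matrix.isUnit_iff_isUnit_det _).1 A.isUnit
  have hcomm' := congrArg Units.val hcomm
  rw [Units.val_mul, Units.val_mul] at hcomm'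
  generalize (A : Matrix (Fin 2) (Fin 2) ℤ) = M at hA hunit hcomm'
  generalize (E : Matrix (Fin 2) (Fin 2) ℤ) = F at hdet hcomm'
  rw [Matrix.det_fin_two] at hdet hunit
  have h1 : M 0 0 * κA + M 0 1 = lamA * κA := by
    simpa [Matrix.mulVec, dotProduct] using congrFun hA 0
  have h2 : M 1 0 * κA + M 1 1 = lamA := by
    simpa [Matrix.mulVec, dotProduct] using congrFun hA 1
  have hirr := irrational_of_eigenvector hunit hlamA h1 h2
  have hc : (M 1 0 : ℝ) ≠ 0 := by
    intro hc
    have hc' : M 1 0 = 0 := by exact_mod_cast hc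
    rw [hc', mul_zero, sub_zero] at hunit
    have hu := isUnit_of_mul_isUnit_right hunit
    rw [Int.isUnit_iff_abs_eq] at hu
    rw [hc, zero_mul, zero_add] at h2
    rw [← h2, ← Int.cast_abs, hu] at hlamA
    norm_num at hlamA
  have e00 := congrFun (congrFun hcomm' 0) 0
  have e10 := congrFun (congrFun hcomm' 1) 0
  simp only [Matrix.mul_apply, Fin.sum_univ_two] at e00 e10
  have e00' : (F 0 0 * M 0 0 + F 0 1 * M 1 0 : ℝ) = M 0 0 * F 0 0 + M 0 1 * F 1 0 := by
    exact_mod_cast e00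
  have e10' : (F 1 0 * M 0 0 + F 1 1 * M 1 0 : ℝ) = M 1 0 * F 0 0 + M 1 1 * F 1 0 := by
    exact_mod_cast e10
  have hfix : (F 0 0 * κA + F 0 1 : ℝ) = κA * (F 1 0 * κA + F 1 1) := by
    apply mul_left_cancel₀ hc
    linear_combination e00' - κA * e10' + (F 1 0 : ℝ) * (h1 - κA * h2)
  obtain ⟨k, hk, hper⟩ :=
    exists_odd_period_of_tailEquiv_self (tailEquiv_self_of_det_eq_neg_one hdet hirr hfix)
  exact Nat.not_even_iff_odd.2 hk (heven.trans_dvd (dvd_of_isLeast_eventual_period hq hper))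
end
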